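/- arXiv:1502.01692 — 2 statements merged into one kernel-verified Lean document; each statement's English description precedes it below -/
import Mathlib

section
/- Let t > 0 and let h : (0, ∞) → ℝ be twice continuously differentiable. Define α : ℂ \ {0} → ℝ by α(z) = |z|^{1/2} e^{h(|z|)}. Then the equation ∂_z̄(α⁻¹ ∂_z α)(z) = t²(α(z)² − |z|² α(z)⁻²) holds for all z ≠ 0 if and only if h''(r) + h'(r)/r = 8 t² r sinh(2 h(r)) for all r > 0. -/
open Complex

/-- Wirtinger derivative `∂_z f = (1/2)(∂f/∂x − i ∂f/∂y)` of `f : ℂ → ℂ`. -/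
noncomputable def wd (f : ℂ → ℂ) (z : ℂ) : ℂ :=
  (1 / 2) * (fderiv ℝ f z 1 - Complex.I * fderiv ℝ f z Complex.I)

/-- Wirtinger derivative `∂_z̄ f = (1/2)(∂f/∂x + i ∂f/∂y)` of `f : ℂ → ℂ`. -/
noncomputable def wdbar (f : ℂ → ℂ) (z : ℂ) : ℂ :=
  (1 / 2) * (fderiv ℝ f z 1 + Complex.I * fderiv ℝ f z Complex.I)

lemma hasFDerivAt_ofReal_comp_norm {φ : ℝ → ℝ} {φ' : ℝ} {z : ℂ} (hz : z ≠ 0)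
    (hφ : HasDerivAt φ φ' ‖z‖) :
    HasFDerivAt (fun w : ℂ => ((φ ‖w‖ : ℝ) : ℂ))
      (ofRealCLM.comp ((φ' / ‖z‖) • innerSL ℝ z)) z := by
  have hr : ‖z‖ ≠ 0 := norm_ne_zero_iff.mpr hz
  have h1 : HasFDerivAt (fun w : ℂ => ‖w‖) (‖z‖⁻¹ • innerSL ℝ z) z := by
    have h2 := (hasStrictFDerivAt_norm_sq z).hasFDerivAt.sqrt (pow_ne_zero 2 hr)
    simp only [Real.sqrt_sq (norm_nonneg _)] at h2
    refine h2.congr_fderiv ?_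
    ext v
    simp
    field_simp
  have h3 := ofRealCLM.hasFDerivAt.comp z (hφ.comp_hasFDerivAt z h1)
  refine h3.congr_fderiv ?_
  rw [smul_smul, div_eq_mul_inv]

lemma wd_ofReal_comp_norm {φ : ℝ → ℝ} {φ' : ℝ} {z : ℂ} (hz : z ≠ 0)
    (hφ : HasDerivAt φ φ' ‖z‖) :
    wd (fun w : ℂ => ((φ ‖w‖ : ℝ) : ℂ)) z
      = ((φ' / (2 * ‖z‖) : ℝ) : ℂ) * (starRingEnd ℂ) z := by
  have hr : ‖z‖ ≠ 0 := norm_ne_zero_iff.mpr hz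
  rw [wd, (hasFDerivAt_ofReal_comp_norm hz hφ).fderiv]
  apply Complex.ext <;>
    simp [Complex.inner, -ofReal_div, -ofReal_mul] <;>
    field_simp

lemma wdbar_ofReal_comp_norm_mul_conj {g : ℝ → ℝ} {g' : ℝ} {z : ℂ} (hz : z ≠ 0)
    (hg : HasDerivAt g g' ‖z‖) :
    wdbar (fun w : ℂ => ((g ‖w‖ : ℝ) : ℂ) * (starRingEnd ℂ) w) z
      = ((g ‖z‖ + g' * ‖z‖ / 2 : ℝ) : ℂ) := by
  have hr : ‖z‖ ≠ 0 := norm_ne_zero_iff.mpr hz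
  have hsq : ‖z‖ ^ 2 = z.re ^ 2 + z.im ^ 2 := by
    rw [Complex.sq_norm, Complex.normSq_apply]; ring
  have hmul := (hasFDerivAt_ofReal_comp_norm hz hg).mul
    (Complex.conjCLE.toContinuousLinearMap.hasFDerivAt (x := z))
  have hfd : fderiv ℝ (fun w : ℂ => ((g ‖w‖ : ℝ) : ℂ) * (starRingEnd ℂ) w) z = _ := hmul.fderiv
  rw [wdbar, hfd]
  apply Complex.ext
  · simp [Complex.inner]
    field_simp
    linear_combination (-g') * hsq
  · simp [Complex.inner]
    field_simp
    ring

lemma wdbar_congr {f g : ℂ → ℂ} {z : ℂ} (hfg : f =ᶠ[nhds z] g) : wdbar f z = wdbar g z := by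
  rw [wdbar, wdbar, hfg.fderiv_eq]

lemma hasDerivAt_rpow_mul_exp {h : ℝ → ℝ} {r h' : ℝ} (hr : 0 < r) (hh : HasDerivAt h h' r) :
    HasDerivAt (fun s : ℝ => s ^ ((1 : ℝ) / 2) * Real.exp (h s))
      (r ^ ((1 : ℝ) / 2) * Real.exp (h r) * (1 / (2 * r) + h')) r := by
  have h1 := (Real.hasDerivAt_rpow_const (p := (1 : ℝ) / 2) (Or.inl hr.ne')).mul hh.exp
  refine h1.congr_deriv ?_
  rw [Real.rpow_sub_one hr.ne']
  field_simp

/-- For `α = √|z| exp (h |z|)`, the function `∂_z̄ (α⁻¹ ∂_z α)` is a quarter of the radial Laplacian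
of `h`. -/
lemma wdbar_inv_mul_wd {h : ℝ → ℝ} (hh : ContDiffOn ℝ 2 h (Set.Ioi 0)) {z : ℂ} (hz : z ≠ 0) :
    wdbar (fun w => ((‖w‖ ^ ((1 : ℝ) / 2) * Real.exp (h ‖w‖) : ℝ) : ℂ)⁻¹ *
        wd (fun v => ((‖v‖ ^ ((1 : ℝ) / 2) * Real.exp (h ‖v‖) : ℝ) : ℂ)) w) z
      = (((deriv (deriv h) ‖z‖ + deriv h ‖z‖ / ‖z‖) / 4 : ℝ) : ℂ) := by
  have hr : 0 < ‖z‖ := norm_pos_iff.mpr hz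
  have hd : ∀ r : ℝ, 0 < r → HasDerivAt h (deriv h r) r := fun r hr =>
    ((hh.differentiableOn (by norm_num)).differentiableAt (Ioi_mem_nhds hr)).hasDerivAt
  have hdd : HasDerivAt (deriv h) (deriv (deriv h) ‖z‖) ‖z‖ := by
    have h1 : ContDiffOn ℝ 1 (deriv h) (Set.Ioi 0) :=
      hh.deriv_of_isOpen isOpen_Ioi (by norm_num)
    exact ((h1.differentiableOn (by norm_num)).differentiableAt (Ioi_mem_nhds hr)).hasDerivAt
  have heq : (fun w => ((‖w‖ ^ ((1 : ℝ) / 2) * Real.exp (h ‖w‖) : ℝ) : ℂ)⁻¹ *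
        wd (fun v => ((‖v‖ ^ ((1 : ℝ) / 2) * Real.exp (h ‖v‖) : ℝ) : ℂ)) w) =ᶠ[nhds z]
      fun w => (((1 / (2 * ‖w‖) + deriv h ‖w‖) / (2 * ‖w‖) : ℝ) : ℂ) * (starRingEnd ℂ) w := by
    filter_upwards [isOpen_ne.mem_nhds hz] with w hw
    have hw0 : 0 < ‖w‖ := norm_pos_iff.mpr hw
    rw [wd_ofReal_comp_norm hw (hasDerivAt_rpow_mul_exp hw0 (hd _ hw0)), ← mul_assoc,
      ← Complex.ofReal_inv, ← Complex.ofReal_mul]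
    have : 0 < ‖w‖ ^ ((1 : ℝ) / 2) := Real.rpow_pos_of_pos hw0 _
    congr 2
    generalize ‖w‖ ^ ((1 : ℝ) / 2) = a at *
    field_simp
  have h2r : HasDerivAt (fun s : ℝ => 2 * s) 2 ‖z‖ := by
    simpa using (hasDerivAt_id ‖z‖).const_mul 2
  have hg := (((hasDerivAt_const ‖z‖ (1 : ℝ)).div h2r (by positivity)).add hdd).div h2r
    (by positivity)
  rw [wdbar_congr heq]
  refine (wdbar_ofReal_comp_norm_mul_conj
    (g := fun s => (1 / (2 * s) + deriv h s) / (2 * s)) hz hg).trans ?_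
  congr 1
  simp only [Pi.add_apply, Pi.div_apply]
  field_simp
  ring

lemma sq_rpow_mul_exp_sub {r : ℝ} (hr : 0 < r) (y : ℝ) :
    (r ^ ((1 : ℝ) / 2) * Real.exp y) ^ 2 - r ^ 2 * ((r ^ ((1 : ℝ) / 2) * Real.exp y) ^ 2)⁻¹
      = 2 * r * Real.sinh (2 * y) := by
  have h1 : (r ^ ((1 : ℝ) / 2) * Real.exp y) ^ 2 = r * Real.exp (2 * y) := by
    rw [mul_pow, ← Real.sqrt_eq_rpow, Real.sq_sqrt hr.le, ← Real.exp_nat_mul]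
    norm_num
  rw [h1, Real.sinh_eq, Real.exp_neg]
  field_simp

theorem stmt6 (t : ℝ) (ht : 0 < t) (h : ℝ → ℝ) (hh : ContDiffOn ℝ 2 h (Set.Ioi 0))
    (α : ℂ → ℝ)
    (hα : ∀ z : ℂ, α z = ‖z‖ ^ ((1 : ℝ) / 2) * Real.exp (h ‖z‖)) :
    (∀ z : ℂ, z ≠ 0 →
        wdbar (fun w => ((α w : ℝ) : ℂ)⁻¹ * wd (fun v => ((α v : ℝ) : ℂ)) w) z =
          (t : ℂ) ^ 2 * (((α z : ℝ) : ℂ) ^ 2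
            - (‖z‖ : ℂ) ^ 2 * (((α z : ℝ) : ℂ) ^ 2)⁻¹)) ↔
      (∀ r > (0 : ℝ), deriv (deriv h) r + deriv h r / r
        = 8 * t ^ 2 * r * Real.sinh (2 * h r)) := by
  have key : ∀ z : ℂ, z ≠ 0 →
      (wdbar (fun w => ((α w : ℝ) : ℂ)⁻¹ * wd (fun v => ((α v : ℝ) : ℂ)) w) z =
          (t : ℂ) ^ 2 * (((α z : ℝ) : ℂ) ^ 2 - (‖z‖ : ℂ) ^ 2 * (((α z : ℝ) : ℂ) ^ 2)⁻¹) ↔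
        deriv (deriv h) ‖z‖ + deriv h ‖z‖ / ‖z‖
          = 8 * t ^ 2 * ‖z‖ * Real.sinh (2 * h ‖z‖)) := by
    intro z hz
    obtain rfl : α = fun z => ‖z‖ ^ ((1 : ℝ) / 2) * Real.exp (h ‖z‖) := funext hα
    have hrhs := sq_rpow_mul_exp_sub (norm_pos_iff.mpr hz) (h ‖z‖)
    rw [wdbar_inv_mul_wd hh hz]
    beta_reduce
    rw [← Complex.ofReal_pow, ← Complex.ofReal_pow, ← Complex.ofReal_pow, ← Complex.ofReal_inv,
      ← Complex.ofReal_mul, ← Complex.ofReal_sub, ← Complex.ofReal_mul, Complex.ofReal_inj, hrhs]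
    constructor <;> intro H <;> linarith
  constructor
  · intro H r hr
    have hz : (r : ℂ) ≠ 0 := Complex.ofReal_ne_zero.mpr hr.ne'
    have := (key r hz).1 (H r hz)
    rwa [Complex.norm_of_nonneg hr.le] at this
  · exact fun H z hz => (key z hz).2 (H _ (norm_pos_iff.mpr hz))
end

section
/- Define on ℂ \ {0} the matrix-valued functions a_z(z) = (1/(8z)) diag(1, −1), a_z̄(z) = −(1/(8 conj(z))) diag(1, −1), and φ_∞(z) = [[0, |z|^{1/2}], [z |z|^{−1/2}, 0]]. Then the limiting fiducial solution satisfies the decoupled self-duality equations on ℂ \ {0}: for every z ≠ 0, (i) the curvature vanishes: ∂_z a_z̄(z) − ∂_z̄ a_z(z) + [a_z(z), a_z̄(z)] = 0; (ii) [φ_∞(z), φ_∞(z)*] = 0, where φ_∞(z)* is the conjugate transpose; (iii) φ_∞ is holomorphic with respect to the connection: ∂_z̄ φ_∞(z) + [a_z̄(z), φ_∞(z)] = 0. -/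
open Matrix Complex

/-- Entrywise Wirtinger derivative `∂_z` of a matrix-valued function. -/
noncomputable def wdM (f : ℂ → Matrix (Fin 2) (Fin 2) ℂ) (z : ℂ) : Matrix (Fin 2) (Fin 2) ℂ :=
  Matrix.of fun i j => wd (fun w => f w i j) z

/-- Entrywise Wirtinger derivative `∂_z̄` of a matrix-valued function. -/
noncomputable def wdbarM (f : ℂ → Matrix (Fin 2) (Fin 2) ℂ) (z : ℂ) : Matrix (Fin 2) (Fin 2) ℂ :=
  Matrix.of fun i j => wdbar (fun w => f w i j) z

/-- Matrix commutator. -/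
noncomputable def mcomm {n : ℕ} (a b : Matrix (Fin n) (Fin n) ℂ) : Matrix (Fin n) (Fin n) ℂ :=
  a * b - b * a

/-- A complex differentiable function is annihilated by `∂_z̄`. -/
theorem wdbar_eq_zero_of_differentiableAt {f : ℂ → ℂ} {z : ℂ} (hf : DifferentiableAt ℂ f z) :
    wdbar f z = 0 := by
  have h := hf.hasDerivAt.complexToReal_fderiv
  rw [wdbar, h.fderiv]
  simp only [_root_.smul_apply, one_apply_eq_self, smul_eq_mul]
  linear_combination (1 / 2) * deriv f z * Complex.I_mul_I

/-- The composition of a complex differentiable function with conjugation is annihilated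
by `∂_z`. -/
theorem wd_comp_conj_eq_zero {f : ℂ → ℂ} {z : ℂ}
    (hf : DifferentiableAt ℂ f (starRingEnd ℂ z)) :
    wd (fun w => f (starRingEnd ℂ w)) z = 0 := by
  have h := hf.hasDerivAt.complexToReal_fderiv.comp z Complex.conjCLE.hasFDerivAt
  have h' : HasFDerivAt (fun w => f (starRingEnd ℂ w)) _ z := h
  rw [wd, h'.fderiv]
  simp
  linear_combination deriv f (starRingEnd ℂ z) * Complex.I_mul_I

theorem hasFDerivAt_norm_rpow_of_ne_zero {z : ℂ} (hz : z ≠ 0) (s : ℝ) :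
    HasFDerivAt (fun w : ℂ => ‖w‖ ^ s) ((s * ‖z‖ ^ (s - 2)) • innerSL ℝ z) z := by
  have hpos : 0 < ‖z‖ := norm_pos_iff.mpr hz
  have h := ((hasStrictFDerivAt_norm_sq z).hasFDerivAt).rpow_const (p := s / 2)
    (Or.inl (by positivity))
  have hpow (t : ℝ) (w : ℂ) : (‖w‖ ^ 2) ^ t = ‖w‖ ^ (2 * t) := by
    rw [← Real.rpow_natCast, ← Real.rpow_mul (norm_nonneg w), Nat.cast_ofNat]
  simp only [hpow] at h
  rw [show 2 * (s / 2) = s by ring, show 2 * (s / 2 - 1) = s - 2 by ring] at h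
  refine h.congr_fderiv ?_
  ext v
  simp
  ring

/-- `∂_z̄ (g |z|^s) = (s / 2) g |z|^s / z̄` for `g` holomorphic. -/
theorem wdbar_mul_norm_rpow {g : ℂ → ℂ} {z : ℂ} (hg : DifferentiableAt ℂ g z) (hz : z ≠ 0)
    (s : ℝ) :
    wdbar (fun w => g w * ((‖w‖ ^ s : ℝ) : ℂ)) z =
      s / 2 * (g z * ((‖z‖ ^ s : ℝ) : ℂ)) / starRingEnd ℂ z := by
  have hpos : 0 < ‖z‖ := norm_pos_iff.mpr hz
  have hn : HasFDerivAt (fun w : ℂ => ((‖w‖ ^ s : ℝ) : ℂ)) _ z :=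
    Complex.ofRealCLM.hasFDerivAt.comp z (hasFDerivAt_norm_rpow_of_ne_zero hz s)
  have h : HasFDerivAt (fun w => g w * ((‖w‖ ^ s : ℝ) : ℂ)) _ z :=
    hg.hasDerivAt.complexToReal_fderiv.mul hn
  have hc : starRingEnd ℂ z ≠ 0 := (map_ne_zero _).mpr hz
  have hs : ((‖z‖ ^ s : ℝ) : ℂ) = ((‖z‖ ^ (s - 2) : ℝ) : ℂ) * (z * starRingEnd ℂ z) := by
    rw [Complex.mul_conj, Complex.normSq_eq_norm_sq, ← Complex.ofReal_mul, ← Real.rpow_natCast,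
      ← Real.rpow_add hpos]
    norm_num
  have h1 : wdbar (fun w => g w * ((‖w‖ ^ s : ℝ) : ℂ)) z =
      g z * (s / 2 * ((‖z‖ ^ (s - 2) : ℝ) : ℂ)) * z := by
    rw [wdbar, h.fderiv]
    simp [Complex.inner]
    linear_combination (1 / 2) * deriv g z * ((‖z‖ ^ s : ℝ) : ℂ) * Complex.I_mul_I +
      g z * (s / 2 * ((‖z‖ ^ (s - 2) : ℝ) : ℂ)) * Complex.re_add_im z
  rw [h1, hs]
  field_simp

theorem mcomm_smul_diag_offDiag (c p q : ℂ) :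
    mcomm (c • (!![1, 0; 0, -1] : Matrix (Fin 2) (Fin 2) ℂ)) !![0, p; q, 0] =
      !![0, 2 * c * p; -(2 * c * q), 0] := by
  ext i j
  fin_cases i <;> fin_cases j <;> simp [mcomm] <;> ring

theorem mcomm_offDiag_conjTranspose_eq_zero {p q : ℂ}
    (h : p * starRingEnd ℂ p = q * starRingEnd ℂ q) :
    mcomm !![0, p; q, 0] !![0, p; q, 0]ᴴ = 0 := by
  have hstar : !![0, p; q, 0]ᴴ = !![0, starRingEnd ℂ q; starRingEnd ℂ p, 0] := by
    ext i j
    fin_cases i <;> fin_cases j <;> simp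
  rw [hstar]
  ext i j
  fin_cases i <;> fin_cases j <;> simp [mcomm]
  · linear_combination h
  · linear_combination -h

theorem stmt12 (az azbar phiInf : ℂ → Matrix (Fin 2) (Fin 2) ℂ)
    (haz : ∀ z : ℂ, az z = (1 / (8 * z)) • (!![1, 0; 0, -1] : Matrix (Fin 2) (Fin 2) ℂ))
    (hazbar : ∀ z : ℂ, azbar z =
      (-(1 / (8 * (starRingEnd ℂ) z))) • (!![1, 0; 0, -1] : Matrix (Fin 2) (Fin 2) ℂ))
    (hphi : ∀ z : ℂ, phiInf z =
      !![0, ((‖z‖ ^ ((1 : ℝ) / 2) : ℝ) : ℂ);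
         z * ((‖z‖ ^ (-(1 : ℝ) / 2) : ℝ) : ℂ), 0]) :
    ∀ z : ℂ, z ≠ 0 →
      wdM azbar z - wdbarM az z + mcomm (az z) (azbar z) = 0 ∧
      mcomm (phiInf z) (phiInf z)ᴴ = 0 ∧
      wdbarM phiInf z + mcomm (azbar z) (phiInf z) = 0 := by
  obtain rfl : az = _ := funext haz
  obtain rfl : azbar = _ := funext hazbar
  obtain rfl : phiInf = _ := funext hphi
  intro z hz
  have hpos : 0 < ‖z‖ := norm_pos_iff.mpr hz
  have hc : starRingEnd ℂ z ≠ 0 := (map_ne_zero _).mpr hz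
  refine ⟨?_, ?_, ?_⟩
  · have hbar (c : ℂ) : wdbar (fun w => 1 / (8 * w) * c) z = 0 := by
      apply wdbar_eq_zero_of_differentiableAt
      have : 8 * z ≠ 0 := by simpa
      fun_prop (disch := assumption)
    have hd (c : ℂ) : wd (fun w => -(1 / (8 * starRingEnd ℂ w)) * c) z = 0 := by
      apply wd_comp_conj_eq_zero (f := fun w => -(1 / (8 * w)) * c)
      have : 8 * starRingEnd ℂ z ≠ 0 := by simpa
      fun_prop (disch := assumption)
    ext i j
    simp only [wdM, wdbarM, Matrix.add_apply, Matrix.sub_apply, Matrix.of_apply,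
      Matrix.smul_apply, smul_eq_mul, hbar, hd, mcomm, Matrix.smul_mul, Matrix.mul_smul,
      Matrix.zero_apply]
    ring
  · have hsq : (‖z‖ ^ ((1 : ℝ) / 2)) * ‖z‖ ^ ((1 : ℝ) / 2) = ‖z‖ := by
      rw [← Real.rpow_add hpos]
      norm_num
    have hinv : (‖z‖ ^ (-(1 : ℝ) / 2)) * ‖z‖ ^ (-(1 : ℝ) / 2) = ‖z‖⁻¹ := by
      rw [← Real.rpow_add hpos, ← Real.rpow_neg_one]
      norm_num
    have hnorm : z * starRingEnd ℂ z * (‖z‖⁻¹ : ℝ) = ‖z‖ := by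
      rw [Complex.mul_conj, Complex.normSq_eq_norm_sq, ← Complex.ofReal_mul]
      congr 1
      field_simp
    rw [← hinv, Complex.ofReal_mul] at hnorm
    have hsq' := congrArg Complex.ofReal hsq
    rw [Complex.ofReal_mul] at hsq'
    apply mcomm_offDiag_conjTranspose_eq_zero
    simp only [map_mul, Complex.conj_ofReal]
    linear_combination hsq' - hnorm
  · have h1 := wdbar_mul_norm_rpow (g := fun _ => 1) (differentiableAt_const 1) hz (1 / 2)
    have h2 := wdbar_mul_norm_rpow (g := fun w => w) differentiableAt_id hz (-1 / 2)
    have h0 : wdbar (fun _ => 0) z = 0 :=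
      wdbar_eq_zero_of_differentiableAt (differentiableAt_const 0)
    simp only [one_mul] at h1
    rw [mcomm_smul_diag_offDiag]
    ext i j
    fin_cases i <;> fin_cases j <;> simp [wdbarM]
    · exact h0
    · rw [← one_div, h1]
      push_cast
      field_simp
      ring
    · rw [h2]
      push_cast
      field_simp
      ring
    · exact h0
end
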